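/- Let λ be a shape of W and let N be a group of automorphisms of W each of which maps S onto S (so N acts on subsets of S, and, extended ℂ-linearly, acts on ℂW preserving Σ(W)). Let σ, σ₁ : 2^S → ℝ_{>0} and suppose that S_λ is N-stable, that π(e^σ_λ) = e^σ_λ for every π ∈ N, and that σ₁(π(I)) = σ₁(I) for every π ∈ N and I ⊆ S. Then there is a unit v of Σ(W) with π(v) = v for every π ∈ N and v e^σ_λ = e^{σ₁}_λ v; in particular left multiplication by v is an isomorphism of right ℂW-modules E^σ_λ → E^{σ₁}_λ commuting with the action of N on ℂW. (In the paper N is a subgroup of the unitary normalizer N(W) = {n : n(Δ) = Δ} acting by conjugation.) -/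

import Mathlib

open scoped Classical
open MonoidAlgebra Finset

noncomputable section

namespace DPR

variable {B : Type} {W : Type} [Group W] [Fintype W] [DecidableEq W]
  {M : CoxeterMatrix B}

/-- The set `S` of simple reflections of the Coxeter system, as a finset of `W`. -/
def Simples (cs : CoxeterSystem M W) : Finset W :=
  Finset.univ.filter (fun w => ∃ i, cs.simple i = w)

/-- The set `W^I` of minimal length left coset representatives of `W_I`,
computed inside the subset `H` of `W` (take `H = Set.univ` for the absolute case). -/
def minCoset (cs : CoxeterSystem M W) (H : Set W) (I : Finset W) : Finset W :=
  Finset.univ.filter (fun w => w ∈ H ∧ ∀ s ∈ I, cs.length w < cs.length (w * s))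

/-- The element `x_I = ∑_{w ∈ W^I} w` of the group algebra `ℂ W`, relative to `H`. -/
def xRel (cs : CoxeterSystem M W) (H : Set W) (I : Finset W) : MonoidAlgebra ℂ W :=
  ∑ w ∈ minCoset cs H I, of ℂ W w

/-- `w(Δ_J) ⊆ Δ_D`:  for every `s ∈ J`, `wsw⁻¹ ∈ D` and `ℓ(ws) = ℓ(w) + 1`. -/
def Takes (cs : CoxeterSystem M W) (D : Finset W) (w : W) (J : Finset W) : Prop :=
  ∀ s ∈ J, w * s * w⁻¹ ∈ D ∧ cs.length (w * s) = cs.length w + 1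

/-- `ᵂJ = wJw⁻¹`. -/
def conjF (w : W) (J : Finset W) : Finset W := J.image (fun s => w * s * w⁻¹)

/-- The coefficient `m^σ_{JK}`, computed relative to the pair `(H, D)`
(`H = Set.univ`, `D = S` in the absolute case). -/
def mC (cs : CoxeterSystem M W) (H : Set W) (D : Finset W) (σ : Finset W → ℝ)
    (J K : Finset W) : ℝ :=
  if J ⊆ K then
    ∑ w ∈ (minCoset cs H K).filter (fun w => Takes cs D w J), σ (conjF w J)
  else 0

/-- The family `(e_J)` is a family of BBHT quasi-idempotents, relative to `(H, D, σ)`: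
it solves the defining triangular system `x_K = ∑_{J ⊆ K} m^σ_{JK} e_J` for all `K ⊆ D`. -/
def IsBBHT (cs : CoxeterSystem M W) (H : Set W) (D : Finset W) (σ : Finset W → ℝ)
    (e : Finset W → MonoidAlgebra ℂ W) : Prop :=
  ∀ K ∈ D.powerset, xRel cs H K = ∑ J ∈ K.powerset, (mC cs H D σ J K : ℂ) • e J

/-- `σ` takes positive values (on subsets of `D`). -/
def PosOn (D : Finset W) (σ : Finset W → ℝ) : Prop := ∀ I ∈ D.powerset, 0 < σ I

/-- Two subsets of `S` have the same shape if the parabolic subgroups they generate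
are conjugate in `W`. -/
def ShapeEq (I J : Finset W) : Prop :=
  ∃ w : W, Subgroup.closure (J : Set W) =
    Subgroup.map (MulAut.conj w).toMonoidHom (Subgroup.closure (I : Set W))

/-- Solomon's descent algebra, as a subspace of the group algebra: the span of the `x_I`. -/
def descAlg (cs : CoxeterSystem M W) : Submodule ℂ (MonoidAlgebra ℂ W) :=
  Submodule.span ℂ {a | ∃ I ∈ (Simples cs).powerset, a = xRel cs Set.univ I}

set_option linter.unusedSectionVars false

/-- The elementary step of the action of `W` on `W × ℤ/2` (restricting, on reflections, to the
action of `W` on roots). -/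
def signStep (cs : CoxeterSystem M W) (i : B) : Function.End (W × ZMod 2) :=
  fun p => (cs.simple i * p.1 * (cs.simple i)⁻¹, p.2 + if p.1 = cs.simple i then 1 else 0)

theorem signStep_pow_apply (cs : CoxeterSystem M W) (i j : B) (n : ℕ) (p : W × ZMod 2) :
    ((signStep cs i * signStep cs j) ^ n) p =
      ((cs.simple i * cs.simple j) ^ n * p.1 * ((cs.simple i * cs.simple j) ^ n)⁻¹,
        p.2 + ∑ k ∈ range (2 * n),
          if p.1 = cs.simple j * (cs.simple i * cs.simple j) ^ k then 1 else 0) := by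
  have hinv : ∀ k : ℕ, ((cs.simple i * cs.simple j) ^ k)⁻¹ * cs.simple j
      = cs.simple j * (cs.simple i * cs.simple j) ^ k := by
    intro k
    induction k with
    | zero => simp
    | succ k ih =>
      rw [pow_succ, mul_inv_rev, mul_assoc, ih, ← pow_succ, pow_succ']
      simp [mul_assoc]
  induction n with
  | zero => simp; rfl
  | succ n ih =>
    rw [pow_succ', show 2 * (n + 1) = 2 * n + 1 + 1 by ring, sum_range_succ, sum_range_succ]
    change (signStep cs i * signStep cs j) (((signStep cs i * signStep cs j) ^ n) p) = _
    rw [ih]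
    change signStep cs i (signStep cs j _) = _
    set r := cs.simple i * cs.simple j with hr
    have h1 : (r ^ n * p.1 * (r ^ n)⁻¹ = cs.simple j) ↔ p.1 = cs.simple j * r ^ (2 * n) := by
      rw [two_mul, pow_add, ← mul_assoc, ← hinv n, mul_inv_eq_iff_eq_mul, mul_assoc,
        eq_inv_mul_iff_mul_eq]
    have h2 : (cs.simple j * (r ^ n * p.1 * (r ^ n)⁻¹) * (cs.simple j)⁻¹ = cs.simple i) ↔
        p.1 = cs.simple j * r ^ (2 * n + 1) := by
      have : cs.simple j * r ^ (2 * n + 1) = (r ^ n)⁻¹ * (cs.simple j * r) * r ^ n := by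
        rw [← mul_assoc, hinv n, show 2 * n + 1 = n + 1 + n by ring, pow_add, pow_add]
        simp [mul_assoc]
      rw [this, mul_inv_eq_iff_eq_mul, ← hr]
      constructor
      · intro h
        have h' : r ^ n * p.1 * (r ^ n)⁻¹ = cs.simple j * r := by
          have := congrArg (cs.simple j * ·) h
          simpa only [cs.simple_mul_simple_cancel_left] using this
        rw [← h']; group
      · intro h
        rw [h]; simp [mul_assoc]
    simp only [signStep, h1, h2]
    ext
    · simp [pow_succ', hr, mul_assoc]
    · simp only [add_assoc]

theorem signStep_isLiftable (cs : CoxeterSystem M W) : M.IsLiftable (signStep cs) := by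
  intro i j
  funext p
  rw [signStep_pow_apply, cs.simple_mul_simple_pow, two_mul, sum_range_add]
  have : ∀ k, (cs.simple i * cs.simple j) ^ (M i j + k) = (cs.simple i * cs.simple j) ^ k := by
    intro k; rw [pow_add, cs.simple_mul_simple_pow, one_mul]
  simp only [this, CharTwo.add_self_eq_zero]
  simp; rfl

/-- The action of `W` on `W × ℤ/2` refining conjugation. -/
def signAct (cs : CoxeterSystem M W) : W →* Function.End (W × ZMod 2) :=
  cs.lift ⟨signStep cs, signStep_isLiftable cs⟩

/-- The sign cocycle: for a reflection `t` with positive root `α`, `signCocycle cs w t = 0`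
if and only if `w(α)` is positive. -/
def signCocycle (cs : CoxeterSystem M W) (w t : W) : ZMod 2 := (signAct cs w (t, 0)).2

theorem signAct_simple (cs : CoxeterSystem M W) (i : B) :
    signAct cs (cs.simple i) = signStep cs i :=
  cs.lift_apply_simple (signStep_isLiftable cs) i

theorem signAct_apply (cs : CoxeterSystem M W) (w t : W) (a : ZMod 2) :
    signAct cs w (t, a) = (w * t * w⁻¹, a + signCocycle cs w t) := by
  induction w using cs.simple_induction_left generalizing a with
  | one =>
    rw [signCocycle, map_one]
    change (t, a) = (1 * t * 1⁻¹, a + 0)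
    simp
  | mul_simple_left w i ih =>
    have key : ∀ a, signAct cs (cs.simple i * w) (t, a) =
        signStep cs i (w * t * w⁻¹, a + signCocycle cs w t) := by
      intro a
      rw [map_mul, signAct_simple, ← ih]; rfl
    rw [key]
    have : signCocycle cs (cs.simple i * w) t =
        (signStep cs i (w * t * w⁻¹, 0 + signCocycle cs w t)).2 := by
      rw [← key]; rfl
    rw [this]
    simp [signStep, mul_assoc, add_assoc]

theorem signCocycle_mul (cs : CoxeterSystem M W) (x y t : W) :
    signCocycle cs (x * y) t = signCocycle cs x (y * t * y⁻¹) + signCocycle cs y t := by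
  have : signAct cs (x * y) (t, 0) = signAct cs x (signAct cs y (t, 0)) := by
    rw [map_mul]; rfl
  rw [signAct_apply, signAct_apply, signAct_apply] at this
  simpa [add_comm] using congrArg Prod.snd this

theorem signCocycle_one (cs : CoxeterSystem M W) (t : W) : signCocycle cs 1 t = 0 := by
  simp [signCocycle, map_one]; rfl

theorem signCocycle_simple (cs : CoxeterSystem M W) (i : B) (t : W) :
    signCocycle cs (cs.simple i) t = if t = cs.simple i then 1 else 0 := by
  simp [signCocycle, signAct_simple, signStep]

theorem zmod_two_ne_zero {a : ZMod 2} : a ≠ 0 ↔ a = 1 := by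
  revert a; decide

theorem mem_rightInvSeq_of_signCocycle (cs : CoxeterSystem M W) (ω : List B) (t : W)
    (h : signCocycle cs (cs.wordProd ω) t = 1) : t ∈ cs.rightInvSeq ω := by
  induction ω with
  | nil => simp [signCocycle_one] at h
  | cons i ω ih =>
    rw [cs.wordProd_cons, signCocycle_mul, signCocycle_simple] at h
    rw [CoxeterSystem.rightInvSeq, List.mem_cons]
    by_cases hc : cs.wordProd ω * t * (cs.wordProd ω)⁻¹ = cs.simple i
    · left; rw [← hc]; group
    · rw [if_neg hc, zero_add] at h
      exact Or.inr (ih h)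

theorem signCocycle_reflection_self (cs : CoxeterSystem M W) {t : W} (ht : cs.IsReflection t) :
    signCocycle cs t t = 1 := by
  obtain ⟨w, i, rfl⟩ := ht
  have h0 : signCocycle cs (w⁻¹ * w) (cs.simple i) = 0 := by
    rw [inv_mul_cancel, signCocycle_one]
  rw [signCocycle_mul] at h0
  rw [mul_assoc w, signCocycle_mul, signCocycle_mul, signCocycle_simple]
  have e1 : cs.simple i * w⁻¹ * (w * cs.simple i * w⁻¹) * (cs.simple i * w⁻¹)⁻¹ = cs.simple i := by
    group
  have e2 : w⁻¹ * (w * cs.simple i * w⁻¹) * w⁻¹⁻¹ = cs.simple i := by group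
  rw [← mul_assoc w, e1, e2, if_pos rfl]
  linear_combination h0

/-- The strong exchange condition, in terms of the sign cocycle. -/
theorem signCocycle_eq_one_iff (cs : CoxeterSystem M W) {w t : W} (ht : cs.IsReflection t) :
    signCocycle cs w t = 1 ↔ cs.length (w * t) < cs.length w := by
  have key : ∀ w, signCocycle cs w t = 1 → cs.length (w * t) < cs.length w := by
    intro w h
    obtain ⟨ω, hω, rfl⟩ := cs.exists_isReduced w
    exact (cs.isRightInversion_of_mem_rightInvSeq hω
      (mem_rightInvSeq_of_signCocycle cs ω t h)).2
  refine ⟨key w, fun h => ?_⟩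
  by_contra hne
  have h0 : signCocycle cs w t = 0 := by
    by_contra h'; exact hne (zmod_two_ne_zero.1 h')
  have h1 : signCocycle cs (w * t) t = 1 := by
    rw [signCocycle_mul, signCocycle_reflection_self cs ht, ht.inv, mul_assoc, ht.mul_self, mul_one,
      h0, zero_add]
  have := key _ h1
  rw [mul_assoc, ht.mul_self, mul_one] at this
  omega

theorem signCocycle_eq_zero_iff (cs : CoxeterSystem M W) {w t : W} (ht : cs.IsReflection t) :
    signCocycle cs w t = 0 ↔ cs.length w < cs.length (w * t) := by
  rw [← not_iff_not, ← ne_eq, zmod_two_ne_zero, signCocycle_eq_one_iff cs ht]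
  have := ht.length_mul_left_ne w
  omega

theorem mem_Simples (cs : CoxeterSystem M W) {s : W} : s ∈ Simples cs ↔ ∃ i, cs.simple i = s := by
  simp [Simples]

theorem isReflection_of_mem_Simples (cs : CoxeterSystem M W) {s : W} (hs : s ∈ Simples cs) :
    cs.IsReflection s := by
  obtain ⟨i, rfl⟩ := (mem_Simples cs).1 hs
  exact cs.isReflection_simple i

theorem length_mul_of_mem_Simples (cs : CoxeterSystem M W) {s : W} (hs : s ∈ Simples cs) (w : W) :
    signCocycle cs w s = 0 ∧ cs.length (w * s) = cs.length w + 1 ∨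
      signCocycle cs w s = 1 ∧ cs.length (w * s) + 1 = cs.length w := by
  have hr := isReflection_of_mem_Simples cs hs
  rw [signCocycle_eq_zero_iff cs hr, signCocycle_eq_one_iff cs hr]
  obtain ⟨i, rfl⟩ := (mem_Simples cs).1 hs
  have := cs.length_mul_simple w i
  omega

theorem length_mul_eq_add_one_iff (cs : CoxeterSystem M W) {s : W} (hs : s ∈ Simples cs) (w : W) :
    cs.length (w * s) = cs.length w + 1 ↔ signCocycle cs w s = 0 := by
  rcases length_mul_of_mem_Simples cs hs w with h | h <;> simp [h] ; omega

theorem signCocycle_of_mem_Simples (cs : CoxeterSystem M W) {s : W} (hs : s ∈ Simples cs) (t : W) :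
    signCocycle cs s t = if t = s then 1 else 0 := by
  obtain ⟨i, rfl⟩ := (mem_Simples cs).1 hs
  exact signCocycle_simple cs i t

theorem mem_minCoset_univ (cs : CoxeterSystem M W) {I : Finset W} (hI : I ⊆ Simples cs) {w : W} :
    w ∈ minCoset cs Set.univ I ↔ ∀ s ∈ I, signCocycle cs w s = 0 := by
  simp only [minCoset, mem_filter, mem_univ, Set.mem_univ, true_and]
  exact forall₂_congr fun s hs =>
    (signCocycle_eq_zero_iff cs (isReflection_of_mem_Simples cs (hI hs))).symm

theorem inv_of_mem_Simples (cs : CoxeterSystem M W) {s : W} (hs : s ∈ Simples cs) : s⁻¹ = s :=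
  (isReflection_of_mem_Simples cs hs).inv

theorem mul_self_of_mem_Simples (cs : CoxeterSystem M W) {s : W} (hs : s ∈ Simples cs) :
    s * s = 1 :=
  (isReflection_of_mem_Simples cs hs).mul_self

/-- The elements that can be reduced to `1` by successive right descents in `I`. -/
inductive DescentReachable (cs : CoxeterSystem M W) (I : Finset W) : W → Prop
  | one : DescentReachable cs I 1
  | step (p s : W) (hs : s ∈ I) (hp : signCocycle cs p s = 1)
      (h : DescentReachable cs I (p * s)) : DescentReachable cs I p

theorem DescentReachable.mul_left (cs : CoxeterSystem M W) {I : Finset W} (hI : I ⊆ Simples cs)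
    {s : W} (hs : s ∈ I) {p : W} (hp : DescentReachable cs I p) :
    DescentReachable cs I (s * p) := by
  induction hp with
  | one =>
    refine .step _ s hs ?_ ?_
    · simp [signCocycle_of_mem_Simples cs (hI hs)]
    · rw [mul_one, mul_self_of_mem_Simples cs (hI hs)]; exact .one
  | step p s' hs' hp h ih =>
    by_cases hc : p * s' * p⁻¹ = s
    · rw [← hc, inv_mul_cancel_right]; exact h
    · refine .step _ s' hs' ?_ (by rwa [mul_assoc])
      rw [signCocycle_mul, signCocycle_of_mem_Simples cs (hI hs), if_neg hc, zero_add, hp]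

theorem descentReachable_of_mem_closure (cs : CoxeterSystem M W) {I : Finset W}
    (hI : I ⊆ Simples cs) {p : W} (hp : p ∈ Subgroup.closure (I : Set W)) :
    DescentReachable cs I p := by
  induction hp using Subgroup.closure_induction_left with
  | one => exact .one
  | mul_left s hs y _ ih => exact ih.mul_left cs hI hs
  | inv_mul_cancel s hs y _ ih =>
    rw [inv_of_mem_Simples cs (hI hs)]
    exact ih.mul_left cs hI hs

theorem exists_descent_of_mem_closure (cs : CoxeterSystem M W) {I : Finset W}
    (hI : I ⊆ Simples cs) {p : W} (hp : p ∈ Subgroup.closure (I : Set W)) (hne : p ≠ 1) :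
    ∃ s ∈ I, signCocycle cs p s = 1 := by
  cases descentReachable_of_mem_closure cs hI hp with
  | one => exact absurd rfl hne
  | step _ s hs h => exact ⟨s, hs, h⟩

/-- Every coset `w W_I` contains an element that is positive on all reflections of `W_I`. -/
theorem exists_positive_coset_rep (cs : CoxeterSystem M W) (I : Finset W) (w : W) :
    ∃ u, u⁻¹ * w ∈ Subgroup.closure (I : Set W) ∧
      ∀ t ∈ Subgroup.closure (I : Set W), cs.IsReflection t → signCocycle cs u t = 0 := by
  obtain ⟨u, hu, hmin⟩ := exists_min_image
    (univ.filter fun u : W => u⁻¹ * w ∈ Subgroup.closure (I : Set W)) cs.length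
    ⟨w, by simp [one_mem]⟩
  simp only [mem_filter, mem_univ, true_and] at hu hmin
  refine ⟨u, hu, fun t ht hr => ?_⟩
  by_contra h
  rw [← ne_eq, zmod_two_ne_zero, signCocycle_eq_one_iff cs hr] at h
  have := hmin (u * t) (by
    rw [mul_inv_rev, mul_assoc]; exact mul_mem (inv_mem ht) hu)
  omega

theorem signCocycle_eq_zero_of_mem_minCoset (cs : CoxeterSystem M W) {I : Finset W}
    (hI : I ⊆ Simples cs) {u t : W} (hu : u ∈ minCoset cs Set.univ I)
    (ht : t ∈ Subgroup.closure (I : Set W)) (hr : cs.IsReflection t) :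
    signCocycle cs u t = 0 := by
  obtain ⟨u₀, hu₀, hpos⟩ := exists_positive_coset_rep cs I u
  rw [mem_minCoset_univ cs hI] at hu
  suffices u₀⁻¹ * u = 1 by
    rw [inv_mul_eq_one.1 this] at hpos
    exact hpos t ht hr
  by_contra hne
  obtain ⟨s, hs, h1⟩ := exists_descent_of_mem_closure cs hI hu₀ hne
  have h2 := hu s hs
  rw [← mul_inv_cancel_left u₀ u, signCocycle_mul, h1, hpos] at h2
  · exact absurd h2 (by decide)
  · exact mul_mem (mul_mem hu₀ (Subgroup.subset_closure hs)) (inv_mem hu₀)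
  · exact (isReflection_of_mem_Simples cs (hI hs)).conj _

theorem signCocycle_mul_of_mem_minCoset (cs : CoxeterSystem M W) {I : Finset W}
    (hI : I ⊆ Simples cs) {u p s : W} (hu : u ∈ minCoset cs Set.univ I)
    (hp : p ∈ Subgroup.closure (I : Set W)) (hs : s ∈ Subgroup.closure (I : Set W))
    (hr : cs.IsReflection s) :
    signCocycle cs (u * p) s = signCocycle cs p s := by
  rw [signCocycle_mul, signCocycle_eq_zero_of_mem_minCoset cs hI hu
    (mul_mem (mul_mem hp hs) (inv_mem hp)) (hr.conj _), zero_add]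

theorem length_mul_of_mem_minCoset (cs : CoxeterSystem M W) {I : Finset W}
    (hI : I ⊆ Simples cs) {u p : W} (hu : u ∈ minCoset cs Set.univ I)
    (hp : p ∈ Subgroup.closure (I : Set W)) :
    cs.length (u * p) = cs.length u + cs.length p := by
  have step : ∀ x ∈ Subgroup.closure (I : Set W), ∀ s ∈ I,
      cs.length (u * x) = cs.length u + cs.length x →
      cs.length (u * (x * s)) = cs.length u + cs.length (x * s) := by
    intro x hx s hs ih
    have h := signCocycle_mul_of_mem_minCoset cs hI hu hx (Subgroup.subset_closure hs)
      (isReflection_of_mem_Simples cs (hI hs))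
    rw [← mul_assoc]
    rcases length_mul_of_mem_Simples cs (hI hs) (u * x) with h1 | h1 <;>
      rcases length_mul_of_mem_Simples cs (hI hs) x with h2 | h2 <;>
      rw [h1.1, h2.1] at h
    · omega
    · exact absurd h (by decide)
    · exact absurd h (by decide)
    · omega
  induction hp using Subgroup.closure_induction_right with
  | one => simp
  | mul_right x hx s hs ih => exact step x hx s hs ih
  | mul_inv_cancel x hx s hs ih =>
    rw [inv_of_mem_Simples cs (hI hs)]
    exact step x hx s hs ih

/-- The minimal representative of the coset `w W_I`. -/
def cosetRep (cs : CoxeterSystem M W) (I : Finset W) (w : W) : W :=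
  (exists_positive_coset_rep cs I w).choose

theorem cosetRep_inv_mul_mem (cs : CoxeterSystem M W) (I : Finset W) (w : W) :
    (cosetRep cs I w)⁻¹ * w ∈ Subgroup.closure (I : Set W) :=
  (exists_positive_coset_rep cs I w).choose_spec.1

theorem cosetRep_mem_minCoset (cs : CoxeterSystem M W) {I : Finset W} (hI : I ⊆ Simples cs)
    (w : W) : cosetRep cs I w ∈ minCoset cs Set.univ I :=
  (mem_minCoset_univ cs hI).2 fun s hs => (exists_positive_coset_rep cs I w).choose_spec.2 s
    (Subgroup.subset_closure hs) (isReflection_of_mem_Simples cs (hI hs))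

theorem cosetRep_mul (cs : CoxeterSystem M W) {I : Finset W} (hI : I ⊆ Simples cs)
    {u p : W} (hu : u ∈ minCoset cs Set.univ I) (hp : p ∈ Subgroup.closure (I : Set W)) :
    cosetRep cs I (u * p) = u := by
  set r := cosetRep cs I (u * p) with hr
  have h1 : r⁻¹ * u ∈ Subgroup.closure (I : Set W) := by
    have := mul_mem (cosetRep_inv_mul_mem cs I (u * p)) (inv_mem hp)
    rwa [mul_assoc, mul_inv_cancel_right] at this
  have h2 := length_mul_of_mem_minCoset cs hI (cosetRep_mem_minCoset cs hI (u * p)) h1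
  have h3 := length_mul_of_mem_minCoset cs hI hu (inv_mem h1)
  rw [← hr, mul_inv_cancel_left] at h2
  rw [mul_inv_rev, inv_inv, mul_inv_cancel_left] at h3
  have : cs.length (r⁻¹ * u) = 0 := by omega
  exact inv_mul_eq_one.1 (cs.length_eq_zero_iff.1 this)

theorem mem_of_length_eq_one_of_mem_closure (cs : CoxeterSystem M W) {I : Finset W}
    (hI : I ⊆ Simples cs) {t : W} (ht : t ∈ Subgroup.closure (I : Set W))
    (h : cs.length t = 1) : t ∈ I := by
  obtain ⟨s, hs, h1⟩ := exists_descent_of_mem_closure cs hI ht (by rintro rfl; simp at h)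
  rw [signCocycle_eq_one_iff cs (isReflection_of_mem_Simples cs (hI hs)), h, Nat.lt_one_iff,
    cs.length_eq_zero_iff, mul_eq_one_iff_eq_inv, inv_of_mem_Simples cs (hI hs)] at h1
  rwa [h1]

theorem length_of_mem_Simples (cs : CoxeterSystem M W) {s : W} (hs : s ∈ Simples cs) :
    cs.length s = 1 := by
  obtain ⟨i, rfl⟩ := (mem_Simples cs).1 hs
  exact cs.length_simple i

/-- A minimal coset representative of `W_I` that conjugates an element of `W_I` to a simple
reflection does so only for elements of `I`. -/
theorem mem_of_conj_mem_Simples (cs : CoxeterSystem M W) {I : Finset W} (hI : I ⊆ Simples cs)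
    {u t : W} (hu : u ∈ minCoset cs Set.univ I) (ht : t ∈ Subgroup.closure (I : Set W))
    (hs : u * t * u⁻¹ ∈ Simples cs) : t ∈ I := by
  refine mem_of_length_eq_one_of_mem_closure cs hI ht ?_
  have h1 := length_mul_of_mem_minCoset cs hI hu ht
  have h2 := cs.length_mul_le (u * t * u⁻¹) u
  rw [inv_mul_cancel_right, length_of_mem_Simples cs hs] at h2
  have h3 : cs.length t ≠ 0 := by
    rw [ne_eq, cs.length_eq_zero_iff]
    rintro rfl
    have := length_of_mem_Simples cs hs
    simp at this
  omega

theorem signCocycle_eq_zero_of_notMem_closure (cs : CoxeterSystem M W) {I : Finset W}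
    (hI : I ⊆ Simples cs) {b t : W} (hb : b ∈ Subgroup.closure (I : Set W))
    (ht : t ∉ Subgroup.closure (I : Set W)) : signCocycle cs b t = 0 := by
  have step : ∀ s ∈ I, ∀ y ∈ Subgroup.closure (I : Set W), signCocycle cs y t = 0 →
      signCocycle cs (s * y) t = 0 := by
    intro s hs y hy ih
    rw [signCocycle_mul, ih, signCocycle_of_mem_Simples cs (hI hs), if_neg, zero_add]
    intro hc
    apply ht
    have : t = y⁻¹ * s * y := by rw [← hc]; group
    rw [this]
    exact mul_mem (mul_mem (inv_mem hy) (Subgroup.subset_closure hs)) hy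
  induction hb using Subgroup.closure_induction_left with
  | one => exact signCocycle_one cs t
  | mul_left s hs y hy ih => exact step s hs y hy ih
  | inv_mul_cancel s hs y hy ih =>
    rw [inv_of_mem_Simples cs (hI hs)]
    exact step s hs y hy ih

/-- The minimal length double coset representatives of `W_I \ W / W_J`. -/
def doubleReps (cs : CoxeterSystem M W) (I J : Finset W) : Finset W :=
  (minCoset cs Set.univ J).filter fun d => d⁻¹ ∈ minCoset cs Set.univ I

/-- The subset `J ∩ d⁻¹ I d`. -/
def interConj (I J : Finset W) (d : W) : Finset W := J.filter fun s => d * s * d⁻¹ ∈ I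

theorem interConj_subset (I J : Finset W) (d : W) : interConj I J d ⊆ J := filter_subset _ _

theorem conj_mem_of_conj_mem_closure (cs : CoxeterSystem M W) {I : Finset W}
    (hI : I ⊆ Simples cs) {d s : W} (hd : d⁻¹ ∈ minCoset cs Set.univ I) (hs : s ∈ Simples cs)
    (h : d * s * d⁻¹ ∈ Subgroup.closure (I : Set W)) : d * s * d⁻¹ ∈ I := by
  refine mem_of_conj_mem_Simples cs hI hd h ?_
  convert hs using 1
  group

/-- For `u ∈ W^I`, `b ∈ W_I` and `d` minimal in `W_I d`, the product `b d` lies in `W^J` if and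
only if `d` does and `u b d ∈ W^M` with `M = J ∩ d⁻¹ I d`. -/
theorem mul_mem_minCoset_iff (cs : CoxeterSystem M W) {I J : Finset W} (hI : I ⊆ Simples cs)
    (hJ : J ⊆ Simples cs) {u b d : W} (hu : u ∈ minCoset cs Set.univ I)
    (hb : b ∈ Subgroup.closure (I : Set W)) (hd : d⁻¹ ∈ minCoset cs Set.univ I) :
    b * d ∈ minCoset cs Set.univ J ↔ d ∈ minCoset cs Set.univ J ∧
      u * (b * d) ∈ minCoset cs Set.univ (interConj I J d) := by
  have hM : interConj I J d ⊆ Simples cs := (interConj_subset I J d).trans hJ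
  have hdJ : b * d ∈ minCoset cs Set.univ J → d ∈ minCoset cs Set.univ J := by
    intro h
    rw [mem_minCoset_univ cs hJ] at h ⊢
    intro s hs
    by_contra hne
    rw [← ne_eq, zmod_two_ne_zero] at hne
    have h1 := (length_mul_eq_add_one_iff cs (hJ hs) (b * d)).2 (h s hs)
    have h2 := (signCocycle_eq_one_iff cs (isReflection_of_mem_Simples cs (hJ hs))).1 hne
    have h3 := length_mul_of_mem_minCoset cs hI hd (inv_mem hb)
    rw [← mul_inv_rev, cs.length_inv, cs.length_inv, cs.length_inv] at h3
    have h4 := cs.length_mul_le b (d * s)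
    rw [← mul_assoc] at h4
    omega
  have key : ∀ s ∈ interConj I J d,
      signCocycle cs (u * (b * d)) s = signCocycle cs (b * d) s := by
    intro s hs
    obtain ⟨hsJ, hsI⟩ := mem_filter.1 hs
    have hr := isReflection_of_mem_Simples cs (hI hsI)
    rw [← mul_assoc, signCocycle_mul, signCocycle_mul cs b,
      signCocycle_mul_of_mem_minCoset cs hI hu hb (Subgroup.subset_closure hsI) hr]
  constructor
  · intro h
    refine ⟨hdJ h, (mem_minCoset_univ cs hM).2 fun s hs => ?_⟩
    rw [key s hs]
    exact (mem_minCoset_univ cs hJ).1 h s (interConj_subset I J d hs)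
  · rintro ⟨h1, h2⟩
    rw [mem_minCoset_univ cs hJ] at h1 ⊢
    rw [mem_minCoset_univ cs hM] at h2
    intro s hs
    by_cases hc : d * s * d⁻¹ ∈ Subgroup.closure (I : Set W)
    · have hs' : s ∈ interConj I J d :=
        mem_filter.2 ⟨hs, conj_mem_of_conj_mem_closure cs hI hd (hJ hs) hc⟩
      rw [← key s hs']
      exact h2 s hs'
    · rw [signCocycle_mul, h1 s hs, signCocycle_eq_zero_of_notMem_closure cs hI hb hc, add_zero]

theorem subset_interConj_and_takes_iff (cs : CoxeterSystem M W) {I J L : Finset W}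
    (hI : I ⊆ Simples cs) (hJ : J ⊆ Simples cs) (hL : L ⊆ J) {u b d : W}
    (hu : u ∈ minCoset cs Set.univ I) (hb : b ∈ Subgroup.closure (I : Set W))
    (hd : d⁻¹ ∈ minCoset cs Set.univ I) (hv : b * d ∈ minCoset cs Set.univ J) :
    (L ⊆ interConj I J d ∧ Takes cs (Simples cs) (u * (b * d)) L) ↔
      (Takes cs I (b * d) L ∧ Takes cs (Simples cs) u (conjF (b * d) L)) := by
  have hconj : ∀ s : W, u * (b * d) * s * (u * (b * d))⁻¹ =
      u * (b * d * s * (b * d)⁻¹) * u⁻¹ := by intro s; group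
  have hconj' : ∀ s : W, b * d * s * (b * d)⁻¹ = b * (d * s * d⁻¹) * b⁻¹ := by intro s; group
  rw [mem_minCoset_univ cs hJ] at hv
  constructor
  · rintro ⟨h1, h2⟩
    have hmem : ∀ s ∈ L, b * d * s * (b * d)⁻¹ ∈ I := by
      intro s hs
      have h3 := (h2 s hs).1
      rw [hconj] at h3
      refine mem_of_conj_mem_Simples cs hI hu ?_ h3
      rw [hconj']
      exact mul_mem (mul_mem hb (Subgroup.subset_closure (mem_filter.1 (h1 hs)).2)) (inv_mem hb)
    refine ⟨fun s hs => ⟨hmem s hs, ?_⟩, ?_⟩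
    · exact (length_mul_eq_add_one_iff cs (hJ (hL hs)) _).2 (hv s (hL hs))
    · intro t ht
      obtain ⟨s, hs, rfl⟩ := mem_image.1 ht
      refine ⟨hconj s ▸ (h2 s hs).1, ?_⟩
      rw [length_mul_eq_add_one_iff cs (hI (hmem s hs))]
      exact (mem_minCoset_univ cs hI).1 hu _ (hmem s hs)
  · rintro ⟨h1, h2⟩
    refine ⟨fun s hs => mem_filter.2 ⟨hL hs, ?_⟩, fun s hs => ⟨?_, ?_⟩⟩
    · refine conj_mem_of_conj_mem_closure cs hI hd (hJ (hL hs)) ?_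
      have h3 := (h1 s hs).1
      rw [hconj'] at h3
      have : d * s * d⁻¹ = b⁻¹ * (b * (d * s * d⁻¹) * b⁻¹) * b := by group
      rw [this]
      exact mul_mem (mul_mem (inv_mem hb) (Subgroup.subset_closure h3)) hb
    · rw [hconj]
      exact (h2 _ (mem_image_of_mem _ hs)).1
    · rw [length_mul_eq_add_one_iff cs (hJ (hL hs)), signCocycle_mul, hv s (hL hs), add_zero]
      exact (mem_minCoset_univ cs hI).1 hu _ (h1 s hs).1

/-- Reindexing of sums over `W^I × W^J` by double cosets. -/
theorem sum_minCoset_product (cs : CoxeterSystem M W) {I J : Finset W} (hI : I ⊆ Simples cs)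
    (hJ : J ⊆ Simples cs) {A : Type*} [AddCommMonoid A] (f : W → W → A) :
    ∑ u ∈ minCoset cs Set.univ I, ∑ v ∈ minCoset cs Set.univ J,
        f (cosetRep cs I v⁻¹)⁻¹ (u * v) =
      ∑ d ∈ doubleReps cs I J, ∑ w ∈ minCoset cs Set.univ (interConj I J d), f d w := by
  rw [← sum_product', sum_sigma']
  have hrep : ∀ v : W, v * cosetRep cs I v⁻¹ ∈ Subgroup.closure (I : Set W) := by
    intro v
    simpa using inv_mem (cosetRep_inv_mul_mem cs I v⁻¹)
  refine sum_bij' (fun p _ => ⟨(cosetRep cs I p.2⁻¹)⁻¹, p.1 * p.2⟩)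
    (fun q _ => (cosetRep cs I (q.2 * q.1⁻¹), (cosetRep cs I (q.2 * q.1⁻¹))⁻¹ * q.2))
    ?_ ?_ ?_ ?_ ?_
  · rintro ⟨u, v⟩ h
    obtain ⟨hu, hv⟩ := mem_product.1 h
    have hd := cosetRep_mem_minCoset cs hI v⁻¹
    have := (mul_mem_minCoset_iff cs hI hJ hu (hrep v)
      (d := (cosetRep cs I v⁻¹)⁻¹) (by rwa [inv_inv])).1 (by simpa using hv)
    simp only [mem_sigma, doubleReps, mem_filter, inv_inv]
    exact ⟨⟨this.1, hd⟩, by simpa using this.2⟩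
  · rintro ⟨d, w⟩ h
    simp only [mem_sigma, doubleReps, mem_filter] at h
    have hu := cosetRep_mem_minCoset cs hI (w * d⁻¹)
    have hb := cosetRep_inv_mul_mem cs I (w * d⁻¹)
    have := (mul_mem_minCoset_iff cs hI hJ hu hb h.1.2).2 ⟨h.1.1, by simpa [mul_assoc] using h.2⟩
    simp only [mem_product]
    exact ⟨hu, by simpa [mul_assoc] using this⟩
  · rintro ⟨u, v⟩ h
    obtain ⟨hu, hv⟩ := mem_product.1 h
    have h1 : cosetRep cs I (u * (v * cosetRep cs I v⁻¹)) = u := cosetRep_mul cs hI hu (hrep v)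
    simp [mul_assoc, h1]
  · rintro ⟨d, w⟩ h
    simp only [mem_sigma, doubleReps, mem_filter] at h
    have hb := cosetRep_inv_mul_mem cs I (w * d⁻¹)
    have h1 := cosetRep_mul cs hI h.1.2 (inv_mem hb)
    simp only [mul_inv_rev, inv_inv, mul_inv_cancel_left] at h1 ⊢
    have h2 : d⁻¹ * (d * w⁻¹ * cosetRep cs I (w * d⁻¹)) =
        w⁻¹ * cosetRep cs I (w * d⁻¹) := by group
    rw [h2] at h1
    rw [h1, inv_inv]
  · rintro ⟨u, v⟩ _
    rfl

theorem one_mem_minCoset (cs : CoxeterSystem M W) {I : Finset W} (hI : I ⊆ Simples cs) :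
    (1 : W) ∈ minCoset cs Set.univ I :=
  (mem_minCoset_univ cs hI).2 fun s _ => signCocycle_one cs s

theorem minCoset_Simples (cs : CoxeterSystem M W) : minCoset cs Set.univ (Simples cs) = {1} := by
  refine eq_singleton_iff_unique_mem.2 ⟨one_mem_minCoset cs subset_rfl, fun w hw => ?_⟩
  by_contra hne
  obtain ⟨i, hi⟩ := cs.exists_rightDescent_of_ne_one hne
  have h0 := (mem_minCoset_univ cs subset_rfl).1 hw _ ((mem_Simples cs).2 ⟨i, rfl⟩)
  rw [signCocycle_eq_zero_iff cs (cs.isReflection_simple i)] at h0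
  exact absurd hi (not_lt.2 h0.le)

theorem xRel_Simples (cs : CoxeterSystem M W) : xRel cs Set.univ (Simples cs) = 1 := by
  rw [xRel, minCoset_Simples, sum_singleton, map_one]

theorem conjF_subset_of_takes (cs : CoxeterSystem M W) {D J : Finset W} {w : W}
    (h : Takes cs D w J) : conjF w J ⊆ D := by
  intro t ht
  obtain ⟨s, hs, rfl⟩ := mem_image.1 ht
  exact (h s hs).1

theorem takes_iff (cs : CoxeterSystem M W) {D J : Finset W} (hD : D ⊆ Simples cs) {w : W} :
    Takes cs D w J ↔ Takes cs (Simples cs) w J ∧ conjF w J ⊆ D := by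
  refine ⟨fun h => ⟨fun s hs => ⟨hD (h s hs).1, (h s hs).2⟩, conjF_subset_of_takes cs h⟩,
    fun h s hs => ⟨h.2 (mem_image_of_mem _ hs), (h.1 s hs).2⟩⟩

theorem conjF_mul (u v : W) (J : Finset W) : conjF (u * v) J = conjF u (conjF v J) := by
  rw [conjF, conjF, conjF, image_image]
  refine image_congr fun s _ => ?_
  simp [mul_assoc]

theorem mC_of_subset (cs : CoxeterSystem M W) (σ : Finset W → ℝ) {J K : Finset W} (h : J ⊆ K) :
    mC cs Set.univ (Simples cs) σ J K =
      ∑ w ∈ minCoset cs Set.univ K,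
        if Takes cs (Simples cs) w J then σ (conjF w J) else 0 := by
  rw [mC, if_pos h, sum_filter]

theorem mC_self_pos (cs : CoxeterSystem M W) {σ : Finset W → ℝ} (hσ : PosOn (Simples cs) σ)
    {K : Finset W} (hK : K ⊆ Simples cs) : 0 < mC cs Set.univ (Simples cs) σ K K := by
  rw [mC, if_pos subset_rfl]
  refine sum_pos (fun w hw => hσ _ (mem_powerset.2 (conjF_subset_of_takes cs (mem_filter.1 hw).2)))
    ⟨1, mem_filter.2 ⟨one_mem_minCoset cs hK, fun s hs => ⟨by simpa using hK hs, ?_⟩⟩⟩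
  rw [length_mul_eq_add_one_iff cs (hK hs), signCocycle_one]

/-- Elimination in the unitriangular-like system defining the quasi-idempotents. -/
theorem mem_of_triangular (cs : CoxeterSystem M W) {σ : Finset W → ℝ}
    (hσ : PosOn (Simples cs) σ) {V : Type*} [AddCommGroup V] [Module ℂ V] (a : Finset W → V)
    (P : Finset W → Submodule ℂ V) (hP : Monotone P)
    (h : ∀ K ⊆ Simples cs,
      ∑ J ∈ K.powerset, (mC cs Set.univ (Simples cs) σ J K : ℂ) • a J ∈ P K)
    (K : Finset W) (hK : K ⊆ Simples cs) : a K ∈ P K := by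
  induction K using Finset.strongInduction with
  | H K ih =>
    have h1 := h K hK
    rw [← add_sum_erase _ _ (mem_powerset_self K)] at h1
    have h2 : ∑ J ∈ K.powerset.erase K, (mC cs Set.univ (Simples cs) σ J K : ℂ) • a J ∈ P K := by
      refine sum_mem fun J hJ => Submodule.smul_mem _ _ ?_
      obtain ⟨hne, hJK⟩ := mem_erase.1 hJ
      rw [mem_powerset] at hJK
      exact hP hJK (ih J (hJK.ssubset_of_ne hne) (hJK.trans hK))
    have h3 := (Submodule.add_mem_iff_left _ h2).1 h1
    refine (Submodule.smul_mem_iff _ ?_).1 h3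
    exact_mod_cast (mC_self_pos cs hσ hK).ne'

theorem eq_of_triangular (cs : CoxeterSystem M W) {σ : Finset W → ℝ}
    (hσ : PosOn (Simples cs) σ) {V : Type*} [AddCommGroup V] [Module ℂ V] (a b : Finset W → V)
    (h : ∀ K ⊆ Simples cs,
      ∑ J ∈ K.powerset, (mC cs Set.univ (Simples cs) σ J K : ℂ) • a J =
        ∑ J ∈ K.powerset, (mC cs Set.univ (Simples cs) σ J K : ℂ) • b J)
    (K : Finset W) (hK : K ⊆ Simples cs) : a K = b K := by
  have := mem_of_triangular cs hσ (fun K => a K - b K) (fun _ => ⊥) monotone_const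
    (fun K hK => by
      simp only [smul_sub, sum_sub_distrib, h K hK, sub_self, zero_mem]) K hK
  simpa [sub_eq_zero] using this

/-- Solomon's theorem: the product `x_I x_J` as a sum over double cosets. -/
theorem xRel_mul_xRel (cs : CoxeterSystem M W) {I J : Finset W} (hI : I ⊆ Simples cs)
    (hJ : J ⊆ Simples cs) :
    xRel cs Set.univ I * xRel cs Set.univ J =
      ∑ d ∈ doubleReps cs I J, xRel cs Set.univ (interConj I J d) := by
  simp only [xRel, sum_mul_sum, ← map_mul]
  exact sum_minCoset_product cs hI hJ (fun _ w => of ℂ W w)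

/-- The descent algebra as a subalgebra of the group algebra. -/
def descSubalgebra (cs : CoxeterSystem M W) : Subalgebra ℂ (MonoidAlgebra ℂ W) :=
  (descAlg cs).toSubalgebra
    (Submodule.subset_span ⟨Simples cs, mem_powerset_self _, (xRel_Simples cs).symm⟩)
    (by
      intro a b ha hb
      have h : descAlg cs * descAlg cs ≤ descAlg cs := by
        rw [descAlg, Submodule.span_mul_span, Submodule.span_le]
        rintro _ ⟨_, ⟨I, hI, rfl⟩, _, ⟨J, hJ, rfl⟩, rfl⟩
        rw [mem_powerset] at hI hJ
        simp only [xRel_mul_xRel cs hI hJ]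
        exact sum_mem fun d _ => Submodule.subset_span
          ⟨_, mem_powerset.2 ((interConj_subset I J d).trans hJ), rfl⟩
      exact h (Submodule.mul_mem_mul ha hb))

/-- The combinatorial identity between structure constants behind the multiplication rule for
quasi-idempotents. -/
theorem sum_mC_interConj (cs : CoxeterSystem M W) (σ : Finset W → ℝ) {I J L : Finset W}
    (hI : I ⊆ Simples cs) (hJ : J ⊆ Simples cs) (hL : L ⊆ J) :
    ∑ d ∈ doubleReps cs I J, mC cs Set.univ (Simples cs) σ L (interConj I J d) =
      ∑ v ∈ minCoset cs Set.univ J,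
        if Takes cs I v L then mC cs Set.univ (Simples cs) σ (conjF v L) I else 0 := by
  have h1 : ∀ d, mC cs Set.univ (Simples cs) σ L (interConj I J d) =
      ∑ w ∈ minCoset cs Set.univ (interConj I J d),
        if L ⊆ interConj I J d ∧ Takes cs (Simples cs) w L then σ (conjF w L) else 0 := by
    intro d
    by_cases h : L ⊆ interConj I J d
    · simp only [mC_of_subset cs σ h, h, true_and]
    · simp [mC, h]
  simp only [h1]
  rw [← sum_minCoset_product cs hI hJ (fun d w =>
    if L ⊆ interConj I J d ∧ Takes cs (Simples cs) w L then σ (conjF w L) else 0), sum_comm]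
  refine sum_congr rfl fun v hv => ?_
  have hb : v * cosetRep cs I v⁻¹ ∈ Subgroup.closure (I : Set W) := by
    simpa using inv_mem (cosetRep_inv_mul_mem cs I v⁻¹)
  have hd : (cosetRep cs I v⁻¹)⁻¹⁻¹ ∈ minCoset cs Set.univ I := by
    rw [inv_inv]; exact cosetRep_mem_minCoset cs hI v⁻¹
  have key : ∀ u ∈ minCoset cs Set.univ I,
      ((L ⊆ interConj I J (cosetRep cs I v⁻¹)⁻¹ ∧ Takes cs (Simples cs) (u * v) L) ↔
        (Takes cs I v L ∧ Takes cs (Simples cs) u (conjF v L))) := by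
    intro u hu
    have := subset_interConj_and_takes_iff cs hI hJ hL hu hb hd
    rw [mul_inv_cancel_right] at this
    exact this hv
  by_cases hT : Takes cs I v L
  · rw [if_pos hT, mC_of_subset cs σ (conjF_subset_of_takes cs hT)]
    refine sum_congr rfl fun u hu => ?_
    rw [if_congr ((key u hu).trans (and_iff_right hT)) rfl rfl, conjF_mul]
  · rw [if_neg hT]
    refine sum_eq_zero fun u hu => if_neg fun h => hT ((key u hu).1 h).1

/-- The multiplication rule for quasi-idempotents: `e_K x_J` is the sum of the `e_L`, over the
`v ∈ W^J` and `L ⊆ J` with `v(Δ_L) = Δ_K`. -/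
theorem bbht_mul_xRel (cs : CoxeterSystem M W) {σ : Finset W → ℝ} (hσ : PosOn (Simples cs) σ)
    {e : Finset W → MonoidAlgebra ℂ W} (he : IsBBHT cs Set.univ (Simples cs) σ e)
    {J : Finset W} (hJ : J ⊆ Simples cs) (K : Finset W) (hK : K ⊆ Simples cs) :
    e K * xRel cs Set.univ J =
      ∑ L ∈ J.powerset, ∑ v ∈ minCoset cs Set.univ J,
        if Takes cs (Simples cs) v L ∧ conjF v L = K then e L else 0 := by
  refine eq_of_triangular cs hσ (fun K => e K * xRel cs Set.univ J)
    (fun K => ∑ L ∈ J.powerset, ∑ v ∈ minCoset cs Set.univ J,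
      if Takes cs (Simples cs) v L ∧ conjF v L = K then e L else 0) (fun I hI => ?_) K hK
  have hleft : ∑ K ∈ I.powerset,
      (mC cs Set.univ (Simples cs) σ K I : ℂ) • (e K * xRel cs Set.univ J) =
      ∑ L ∈ J.powerset, (∑ d ∈ doubleReps cs I J,
        (mC cs Set.univ (Simples cs) σ L (interConj I J d) : ℂ)) • e L := by
    simp only [← smul_mul_assoc, ← sum_mul]
    rw [← he I (mem_powerset.2 hI), xRel_mul_xRel cs hI hJ]
    simp only [sum_smul]
    rw [sum_comm]
    refine sum_congr rfl fun d _ => ?_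
    rw [he _ (mem_powerset.2 ((interConj_subset I J d).trans hJ))]
    refine sum_subset (powerset_mono.2 (interConj_subset I J d)) fun L _ hL => ?_
    rw [mC, if_neg (by simpa using hL)]
    simp
  rw [hleft]
  simp only [smul_sum]
  rw [sum_comm]
  refine sum_congr rfl fun L hL => ?_
  rw [sum_comm, ← Complex.ofReal_sum, sum_mC_interConj cs σ hI hJ (mem_powerset.1 hL),
    Complex.ofReal_sum, sum_smul]
  refine sum_congr rfl fun v _ => ?_
  by_cases hT : Takes cs I v L
  · have h2 := (takes_iff cs hI).1 hT
    rw [if_pos hT, sum_eq_single (conjF v L)]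
    · rw [if_pos ⟨h2.1, rfl⟩]
    · intro K _ hne
      rw [if_neg fun h => hne h.2.symm, smul_zero]
    · intro h
      exact absurd (mem_powerset.2 h2.2) h
  · rw [if_neg hT, Complex.ofReal_zero, zero_smul]
    symm
    refine sum_eq_zero fun K hK => ?_
    rw [if_neg, smul_zero]
    rintro ⟨h1, rfl⟩
    exact hT ((takes_iff cs hI).2 ⟨h1, mem_powerset.1 hK⟩)

theorem shapeEq_conjF_iff (I L : Finset W) (v : W) : ShapeEq I (conjF v L) ↔ ShapeEq I L := by
  have h : Subgroup.closure ((conjF v L : Finset W) : Set W) =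
      Subgroup.map (MulAut.conj v).toMonoidHom (Subgroup.closure (L : Set W)) := by
    rw [MonoidHom.map_closure, conjF, coe_image]
    rfl
  have hc : ∀ (x y : W) (H : Subgroup W), Subgroup.map (MulAut.conj x).toMonoidHom
      (Subgroup.map (MulAut.conj y).toMonoidHom H) =
      Subgroup.map (MulAut.conj (x * y)).toMonoidHom H := by
    intro x y H
    rw [Subgroup.map_map, map_mul]
    rfl
  unfold ShapeEq
  rw [h]
  constructor
  · rintro ⟨w, hw⟩
    refine ⟨v⁻¹ * w, ?_⟩
    rw [← hc, ← hw, hc, inv_mul_cancel, map_one]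
    exact (Subgroup.map_id _).symm
  · rintro ⟨w, hw⟩
    exact ⟨v * w, by rw [hw, hc]⟩

/-- The idempotent `e_λ` attached to the shape of `I`. -/
def shapeIdem (cs : CoxeterSystem M W) (σ : Finset W → ℝ) (e : Finset W → MonoidAlgebra ℂ W)
    (I : Finset W) : MonoidAlgebra ℂ W :=
  ∑ J ∈ (Simples cs).powerset.filter (fun J => ShapeEq I J), (σ J : ℂ) • e J

theorem shapeIdem_mul_xRel (cs : CoxeterSystem M W) {σ : Finset W → ℝ}
    (hσ : PosOn (Simples cs) σ) {e : Finset W → MonoidAlgebra ℂ W}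
    (he : IsBBHT cs Set.univ (Simples cs) σ e) (I : Finset W) {J : Finset W}
    (hJ : J ⊆ Simples cs) :
    shapeIdem cs σ e I * xRel cs Set.univ J =
      ∑ L ∈ J.powerset, (mC cs Set.univ (Simples cs) σ L J : ℂ) •
        if ShapeEq I L then e L else 0 := by
  rw [shapeIdem, sum_mul]
  have h1 : ∀ K ∈ (Simples cs).powerset.filter (fun J => ShapeEq I J),
      ((σ K : ℂ) • e K) * xRel cs Set.univ J =
      ∑ L ∈ J.powerset, ∑ v ∈ minCoset cs Set.univ J,
        if Takes cs (Simples cs) v L ∧ conjF v L = K then (σ K : ℂ) • e L else 0 := by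
    intro K hK
    rw [smul_mul_assoc, bbht_mul_xRel cs hσ he hJ K (mem_powerset.1 (mem_filter.1 hK).1)]
    simp only [smul_sum, smul_ite, smul_zero]
  rw [sum_congr rfl h1, sum_comm]
  refine sum_congr rfl fun L hL => ?_
  rw [sum_comm, mC_of_subset cs σ (mem_powerset.1 hL), Complex.ofReal_sum, sum_smul]
  refine sum_congr rfl fun v _ => ?_
  by_cases hT : Takes cs (Simples cs) v L
  · rw [if_pos hT]
    by_cases hS : ShapeEq I L
    · rw [if_pos hS, sum_eq_single (conjF v L)]
      · rw [if_pos ⟨hT, rfl⟩]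
      · intro K _ hne
        rw [if_neg fun h => hne h.2.symm]
      · intro h
        exact absurd (mem_filter.2 ⟨mem_powerset.2 (conjF_subset_of_takes cs hT),
          (shapeEq_conjF_iff I L v).2 hS⟩) h
    · rw [if_neg hS, smul_zero]
      refine sum_eq_zero fun K hK => if_neg ?_
      rintro ⟨_, rfl⟩
      exact hS ((shapeEq_conjF_iff I L v).1 (mem_filter.1 hK).2)
  · rw [if_neg hT, Complex.ofReal_zero, zero_smul]
    exact sum_eq_zero fun K _ => if_neg fun h => hT h.1

theorem shapeIdem_mul_bbht (cs : CoxeterSystem M W) {σ : Finset W → ℝ}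
    (hσ : PosOn (Simples cs) σ) {e : Finset W → MonoidAlgebra ℂ W}
    (he : IsBBHT cs Set.univ (Simples cs) σ e) (I K : Finset W) (hK : K ⊆ Simples cs) :
    shapeIdem cs σ e I * e K = if ShapeEq I K then e K else 0 := by
  refine eq_of_triangular cs hσ (fun K => shapeIdem cs σ e I * e K)
    (fun K => if ShapeEq I K then e K else 0) (fun J hJ => ?_) K hK
  rw [← shapeIdem_mul_xRel cs hσ he I hJ, he J (mem_powerset.2 hJ), mul_sum]
  simp only [mul_smul_comm]

theorem shapeIdem_isIdempotentElem (cs : CoxeterSystem M W) {σ : Finset W → ℝ}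
    (hσ : PosOn (Simples cs) σ) {e : Finset W → MonoidAlgebra ℂ W}
    (he : IsBBHT cs Set.univ (Simples cs) σ e) (I : Finset W) :
    IsIdempotentElem (shapeIdem cs σ e I) := by
  change _ * (∑ J ∈ (Simples cs).powerset.filter (fun J => ShapeEq I J), (σ J : ℂ) • e J) =
    ∑ J ∈ (Simples cs).powerset.filter (fun J => ShapeEq I J), (σ J : ℂ) • e J
  rw [mul_sum]
  refine sum_congr rfl fun K hK => ?_
  obtain ⟨h1, h2⟩ := mem_filter.1 hK
  rw [mul_smul_comm, shapeIdem_mul_bbht cs hσ he I K (mem_powerset.1 h1), if_pos h2]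

theorem bbht_mem_span (cs : CoxeterSystem M W) {σ : Finset W → ℝ}
    (hσ : PosOn (Simples cs) σ) {e : Finset W → MonoidAlgebra ℂ W}
    (he : IsBBHT cs Set.univ (Simples cs) σ e) (K : Finset W) (hK : K ⊆ Simples cs) :
    e K ∈ Submodule.span ℂ (xRel cs Set.univ '' Set.Iic K) := by
  refine mem_of_triangular cs hσ e (fun K => Submodule.span ℂ (xRel cs Set.univ '' Set.Iic K))
    (fun K K' h => Submodule.span_mono (Set.image_mono (Set.Iic_subset_Iic.2 h)))
    (fun K hK => ?_) K hK
  rw [← he K (mem_powerset.2 hK)]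
  exact Submodule.subset_span ⟨K, Set.mem_Iic.2 le_rfl, rfl⟩

theorem shapeIdem_mem_descAlg (cs : CoxeterSystem M W) {σ : Finset W → ℝ}
    (hσ : PosOn (Simples cs) σ) {e : Finset W → MonoidAlgebra ℂ W}
    (he : IsBBHT cs Set.univ (Simples cs) σ e) (I : Finset W) :
    shapeIdem cs σ e I ∈ descAlg cs := by
  refine sum_mem fun K hK => Submodule.smul_mem _ _ ?_
  have hK' := mem_powerset.1 (mem_filter.1 hK).1
  refine Submodule.span_mono ?_ (bbht_mem_span cs hσ he K hK')
  rintro _ ⟨L, hL, rfl⟩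
  exact ⟨L, mem_powerset.2 ((Set.mem_Iic.1 hL).trans hK'), rfl⟩

theorem shapeIdem_mul_xRel_sub_mem (cs : CoxeterSystem M W) {σ : Finset W → ℝ}
    (hσ : PosOn (Simples cs) σ) {e : Finset W → MonoidAlgebra ℂ W}
    (he : IsBBHT cs Set.univ (Simples cs) σ e) (I : Finset W) {J : Finset W}
    (hJ : J ⊆ Simples cs) :
    shapeIdem cs σ e I * xRel cs Set.univ J - (if ShapeEq I J then xRel cs Set.univ J else 0) ∈
      Submodule.span ℂ (xRel cs Set.univ '' Set.Iio J) := by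
  have hmem : ∀ L ∈ J.powerset.erase J,
      e L ∈ Submodule.span ℂ (xRel cs Set.univ '' Set.Iio J) := by
    intro L hL
    obtain ⟨hne, hLJ⟩ := mem_erase.1 hL
    rw [mem_powerset] at hLJ
    refine Submodule.span_mono (Set.image_mono fun L' hL' => ?_)
      (bbht_mem_span cs hσ he L (hLJ.trans hJ))
    exact lt_of_le_of_lt (Set.mem_Iic.1 hL') (hLJ.ssubset_of_ne hne)
  have hx : (if ShapeEq I J then xRel cs Set.univ J else 0) =
      ∑ L ∈ J.powerset, (mC cs Set.univ (Simples cs) σ L J : ℂ) •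
        if ShapeEq I J then e L else 0 := by
    split_ifs
    · exact he J (mem_powerset.2 hJ)
    · simp
  rw [hx, shapeIdem_mul_xRel cs hσ he I hJ, ← sum_sub_distrib,
    ← add_sum_erase _ _ (mem_powerset_self J), sub_self, zero_add]
  refine sum_mem fun L hL => ?_
  rw [← smul_sub]
  refine Submodule.smul_mem _ _ (Submodule.sub_mem _ ?_ ?_) <;> split_ifs <;>
    first | exact hmem L hL | exact zero_mem _

theorem shapeIdem_sub_isNilpotent (cs : CoxeterSystem M W) {σ σ₁ : Finset W → ℝ}
    (hσ : PosOn (Simples cs) σ) (hσ₁ : PosOn (Simples cs) σ₁)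
    {e e₁ : Finset W → MonoidAlgebra ℂ W} (he : IsBBHT cs Set.univ (Simples cs) σ e)
    (he₁ : IsBBHT cs Set.univ (Simples cs) σ₁ e₁) (I : Finset W) :
    IsNilpotent (shapeIdem cs σ e I - shapeIdem cs σ₁ e₁ I) := by
  set d := shapeIdem cs σ e I - shapeIdem cs σ₁ e₁ I with hd
  set F : ℕ → Submodule ℂ (MonoidAlgebra ℂ W) := fun n =>
    Submodule.span ℂ (xRel cs Set.univ '' {L | L ⊆ Simples cs ∧ L.card < n}) with hF
  have hstep : ∀ n, ∀ a ∈ F (n + 1), d * a ∈ F n := by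
    intro n a ha
    have hle : F (n + 1) ≤ (F n).comap (LinearMap.mulLeft ℂ d) := by
      refine Submodule.span_le.2 ?_
      rintro _ ⟨J, ⟨hJ, hcard⟩, rfl⟩
      have h := Submodule.sub_mem _ (shapeIdem_mul_xRel_sub_mem cs hσ he I hJ)
        (shapeIdem_mul_xRel_sub_mem cs hσ₁ he₁ I hJ)
      rw [sub_sub_sub_cancel_right, ← sub_mul] at h
      refine Submodule.span_mono (Set.image_mono fun L hL => ?_) h
      have hL : L ⊂ J := hL
      exact ⟨hL.subset.trans hJ, by have := card_lt_card hL; omega⟩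
    exact hle ha
  have hpow : ∀ k n, ∀ a ∈ F (n + k), d ^ k * a ∈ F n := by
    intro k
    induction k with
    | zero => intro n a ha; simpa using ha
    | succ k ih =>
      intro n a ha
      rw [pow_succ, mul_assoc]
      exact ih n _ (hstep _ a ha)
  refine ⟨(Simples cs).card + 1, ?_⟩
  have h1 : (1 : MonoidAlgebra ℂ W) ∈ F (0 + ((Simples cs).card + 1)) :=
    Submodule.subset_span ⟨Simples cs, ⟨subset_rfl, by omega⟩, xRel_Simples cs⟩
  have h0 := hpow _ 0 1 h1
  simpa [hF] using h0

theorem length_map_le (cs : CoxeterSystem M W) {π : MulAut W}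
    (hπ : (Simples cs).image ⇑π = Simples cs) (w : W) : cs.length (π w) ≤ cs.length w := by
  obtain ⟨ω, hω, rfl⟩ := cs.exists_isReduced w
  rw [hω.eq]
  clear hω
  induction ω with
  | nil => simp
  | cons i ω ih =>
    rw [cs.wordProd_cons, map_mul]
    have hs : π (cs.simple i) ∈ Simples cs := by
      rw [← hπ]; exact mem_image_of_mem _ ((mem_Simples cs).2 ⟨i, rfl⟩)
    have := cs.length_mul_le (π (cs.simple i)) (π (cs.wordProd ω))
    rw [length_of_mem_Simples cs hs] at this
    simp only [List.length_cons]
    omega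

theorem length_map (cs : CoxeterSystem M W) {π : MulAut W}
    (hπ : (Simples cs).image ⇑π = Simples cs) (w : W) : cs.length (π w) = cs.length w := by
  refine le_antisymm (length_map_le cs hπ w) ?_
  have hinv : (Simples cs).image ⇑π⁻¹ = Simples cs := by
    conv_lhs => rw [← hπ]
    rw [image_image]
    simp
  simpa using length_map_le cs hinv (π w)

theorem minCoset_image (cs : CoxeterSystem M W) {π : MulAut W}
    (hπ : (Simples cs).image ⇑π = Simples cs) (K : Finset W) :
    minCoset cs Set.univ (K.image ⇑π) = (minCoset cs Set.univ K).image ⇑π := by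
  ext w
  obtain ⟨w, rfl⟩ := π.surjective w
  simp only [minCoset, mem_filter, mem_univ, Set.mem_univ, true_and, mem_image,
    EmbeddingLike.apply_eq_iff_eq, exists_eq_right, forall_exists_index, and_imp,
    forall_apply_eq_imp_iff₂, ← map_mul, length_map cs hπ]

theorem domCongr_xRel (cs : CoxeterSystem M W) {π : MulAut W}
    (hπ : (Simples cs).image ⇑π = Simples cs) (K : Finset W) :
    MonoidAlgebra.domCongr ℂ ℂ (π : W ≃* W) (xRel cs Set.univ K) =
      xRel cs Set.univ (K.image ⇑π) := by
  rw [xRel, xRel, minCoset_image cs hπ, sum_image π.injective.injOn, map_sum]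
  refine sum_congr rfl fun w _ => ?_
  simp [of_apply]

theorem takes_image (cs : CoxeterSystem M W) {π : MulAut W}
    (hπ : (Simples cs).image ⇑π = Simples cs) (w : W) (J : Finset W) :
    Takes cs (Simples cs) (π w) (J.image ⇑π) ↔ Takes cs (Simples cs) w J := by
  have hmem : ∀ x, π x ∈ Simples cs ↔ x ∈ Simples cs := by
    intro x
    conv_lhs => rw [← hπ]
    simp
  simp only [Takes, mem_image, forall_exists_index, and_imp, forall_apply_eq_imp_iff₂,
    ← map_mul, ← map_inv, length_map cs hπ, hmem]

theorem conjF_image (π : MulAut W) (w : W) (J : Finset W) :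
    conjF (π w) (J.image ⇑π) = (conjF w J).image ⇑π := by
  simp only [conjF, image_image]
  refine image_congr fun s _ => ?_
  simp

theorem mC_image (cs : CoxeterSystem M W) {σ : Finset W → ℝ} {π : MulAut W}
    (hπ : (Simples cs).image ⇑π = Simples cs) (hσπ : ∀ J : Finset W, σ (J.image ⇑π) = σ J)
    (J K : Finset W) :
    mC cs Set.univ (Simples cs) σ (J.image ⇑π) (K.image ⇑π) =
      mC cs Set.univ (Simples cs) σ J K := by
  by_cases h : J ⊆ K
  · rw [mC_of_subset cs σ h, mC_of_subset cs σ (image_subset_image h), minCoset_image cs hπ,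
      sum_image π.injective.injOn]
    simp only [takes_image cs hπ, conjF_image, hσπ]
  · rw [mC, mC, if_neg h, if_neg (by rwa [image_subset_image_iff π.injective])]

theorem domCongr_bbht (cs : CoxeterSystem M W) {σ : Finset W → ℝ}
    (hσ : PosOn (Simples cs) σ) {e : Finset W → MonoidAlgebra ℂ W}
    (he : IsBBHT cs Set.univ (Simples cs) σ e) {π : MulAut W}
    (hπ : (Simples cs).image ⇑π = Simples cs) (hσπ : ∀ J : Finset W, σ (J.image ⇑π) = σ J)
    (K : Finset W) (hK : K ⊆ Simples cs) :
    MonoidAlgebra.domCongr ℂ ℂ (π : W ≃* W) (e K) = e (K.image ⇑π) := by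
  refine eq_of_triangular cs hσ (fun K => MonoidAlgebra.domCongr ℂ ℂ (π : W ≃* W) (e K))
    (fun K => e (K.image ⇑π)) (fun K hK => ?_) K hK
  have hK' : K.image ⇑π ⊆ Simples cs := by
    conv_rhs => rw [← hπ]
    exact image_subset_image hK
  have h := he _ (mem_powerset.2 hK')
  rw [← domCongr_xRel cs hπ, he K (mem_powerset.2 hK), map_sum, powerset_image,
    sum_image (image_injective π.injective).injOn] at h
  simpa only [map_smul, mC_image cs hπ hσπ] using h

theorem domCongr_shapeIdem (cs : CoxeterSystem M W) {σ : Finset W → ℝ}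
    (hσ : PosOn (Simples cs) σ) {e : Finset W → MonoidAlgebra ℂ W}
    (he : IsBBHT cs Set.univ (Simples cs) σ e) (I : Finset W) {π : MulAut W}
    (hπ : (Simples cs).image ⇑π = Simples cs) (hσπ : ∀ J : Finset W, σ (J.image ⇑π) = σ J)
    (hlam : ∀ J ∈ (Simples cs).powerset.filter (fun J => ShapeEq I J),
      J.image ⇑π ∈ (Simples cs).powerset.filter (fun J => ShapeEq I J)) :
    MonoidAlgebra.domCongr ℂ ℂ (π : W ≃* W) (shapeIdem cs σ e I) = shapeIdem cs σ e I := by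
  rw [shapeIdem, map_sum]
  have hinj := image_injective π.injective
  have himg : ((Simples cs).powerset.filter (fun J => ShapeEq I J)).image (image ⇑π) =
      (Simples cs).powerset.filter (fun J => ShapeEq I J) :=
    eq_of_subset_of_card_le (image_subset_iff.2 hlam) (card_image_of_injective _ hinj).ge
  conv_rhs => rw [← himg]
  rw [sum_image hinj.injOn]
  refine sum_congr rfl fun J hJ => ?_
  rw [map_smul, domCongr_bbht cs hσ he hπ hσπ J (mem_powerset.1 (mem_filter.1 hJ).1), hσπ]

/-- Two idempotents of a ring are conjugate by the standard intertwiner as soon as their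
difference is nilpotent; the inverse of the intertwiner lies in any subalgebra containing them. -/
theorem exists_inverse_intertwiner {R A : Type*} [CommRing R] [Ring A] [Algebra R A]
    (D : Subalgebra R A) {e f : A} (he : IsIdempotentElem e) (hf : IsIdempotentElem f)
    (heS : e ∈ D) (hfS : f ∈ D) (hnil : IsNilpotent (e - f)) :
    ∃ v' ∈ D, (f * e + (1 - f) * (1 - e)) * v' = 1 ∧ v' * (f * e + (1 - f) * (1 - e)) = 1 := by
  have he' : e * e = e := he
  have hf' : f * f = f := hf
  set v := f * e + (1 - f) * (1 - e) with hv
  set u := e * f + (1 - e) * (1 - f) with hu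
  have e1 : e * (e * f) = e * f := by rw [← mul_assoc, he']
  have e2 : f * (f * e) = f * e := by rw [← mul_assoc, hf']
  have hvu : v * u = 1 - (e - f) * (e - f) := by
    simp only [hv, hu, mul_add, add_mul, mul_sub, sub_mul, mul_one, one_mul, mul_assoc, he', hf',
      e1]
    abel
  have huv : u * v = 1 - (e - f) * (e - f) := by
    simp only [hv, hu, mul_add, add_mul, mul_sub, sub_mul, mul_one, one_mul, mul_assoc, he', hf',
      e2]
    abel
  obtain ⟨n, hn⟩ := hnil
  have hn' : ((e - f) * (e - f)) ^ n = 0 := by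
    rw [(Commute.refl (e - f)).mul_pow, hn, zero_mul]
  set g := ∑ i ∈ range n, ((e - f) * (e - f)) ^ i with hg
  have hr : v * (u * g) = 1 := by
    rw [← mul_assoc, hvu, hg, mul_neg_geom_sum, hn', sub_zero]
  have hl : g * u * v = 1 := by
    rw [mul_assoc, huv, hg, geom_sum_mul_neg, hn', sub_zero]
  have hd : e - f ∈ D := sub_mem heS hfS
  refine ⟨u * g, mul_mem ?_ (sum_mem fun i _ => pow_mem (mul_mem hd hd) i), hr, ?_⟩
  · exact add_mem (mul_mem heS hfS) (mul_mem (sub_mem (one_mem _) heS) (sub_mem (one_mem _) hfS))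
  · rw [← left_inv_eq_right_inv hl hr, hl]

/-- Proposition 4.3: let `N` be a group of automorphisms of `W` mapping `S` onto
`S`, let `λ` be a shape (with representative `I`), and suppose `S_λ` is
`N`-stable, every `π ∈ N` fixes `e^σ_λ`, and `σ₁` is constant on `N`-orbits.
Then there is an `N`-invariant unit `v` of Solomon's descent algebra with
`v e^σ_λ = e^{σ₁}_λ v`; in particular left multiplication by `v` is an
isomorphism of right `ℂW`-modules `E^σ_λ → E^{σ₁}_λ`. -/
theorem stmt8 (cs : CoxeterSystem M W)
    (σ σ₁ : Finset W → ℝ) (hσ : PosOn (Simples cs) σ) (hσ₁ : PosOn (Simples cs) σ₁)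
    (e : Finset W → MonoidAlgebra ℂ W) (he : IsBBHT cs Set.univ (Simples cs) σ e)
    (e₁ : Finset W → MonoidAlgebra ℂ W) (he₁ : IsBBHT cs Set.univ (Simples cs) σ₁ e₁)
    (I : Finset W) (hI : I ⊆ Simples cs)
    (N : Subgroup (MulAut W))
    (hNS : ∀ π ∈ N, (Simples cs).image ⇑π = Simples cs)
    (hNlam : ∀ π ∈ N, ∀ J ∈ (Simples cs).powerset.filter (fun J => ShapeEq I J),
      J.image ⇑π ∈ (Simples cs).powerset.filter (fun J => ShapeEq I J))
    (hNe : ∀ π ∈ N,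
      MonoidAlgebra.domCongr ℂ ℂ (π : W ≃* W)
        (∑ J ∈ (Simples cs).powerset.filter (fun J => ShapeEq I J), (σ J : ℂ) • e J)
      = ∑ J ∈ (Simples cs).powerset.filter (fun J => ShapeEq I J), (σ J : ℂ) • e J)
    (hNσ₁ : ∀ π ∈ N, ∀ J : Finset W, σ₁ (J.image ⇑π) = σ₁ J) :
    ∃ v v' : MonoidAlgebra ℂ W, v ∈ descAlg cs ∧ v' ∈ descAlg cs ∧
      v * v' = 1 ∧ v' * v = 1 ∧
      (∀ π ∈ N, MonoidAlgebra.domCongr ℂ ℂ (π : W ≃* W) v = v) ∧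
      v * (∑ J ∈ (Simples cs).powerset.filter (fun J => ShapeEq I J), (σ J : ℂ) • e J)
        = (∑ J ∈ (Simples cs).powerset.filter (fun J => ShapeEq I J), (σ₁ J : ℂ) • e₁ J) * v ∧
      (fun x => v * x) ''
          (Set.range fun y : MonoidAlgebra ℂ W =>
            (∑ J ∈ (Simples cs).powerset.filter (fun J => ShapeEq I J), (σ J : ℂ) • e J) * y)
        = Set.range fun y : MonoidAlgebra ℂ W =>
            (∑ J ∈ (Simples cs).powerset.filter (fun J => ShapeEq I J), (σ₁ J : ℂ) • e₁ J) * y := by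
  set E := ∑ J ∈ (Simples cs).powerset.filter (fun J => ShapeEq I J), (σ J : ℂ) • e J with hE
  set F := ∑ J ∈ (Simples cs).powerset.filter (fun J => ShapeEq I J), (σ₁ J : ℂ) • e₁ J with hF
  have hEE : E * E = E := shapeIdem_isIdempotentElem cs hσ he I
  have hFF : F * F = F := shapeIdem_isIdempotentElem cs hσ₁ he₁ I
  have hES : E ∈ descSubalgebra cs := shapeIdem_mem_descAlg cs hσ he I
  have hFS : F ∈ descSubalgebra cs := shapeIdem_mem_descAlg cs hσ₁ he₁ I
  have hNF : ∀ π ∈ N, MonoidAlgebra.domCongr ℂ ℂ (π : W ≃* W) F = F := fun π hπ =>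
    domCongr_shapeIdem cs hσ₁ he₁ I (hNS π hπ) (hNσ₁ π hπ) (hNlam π hπ)
  obtain ⟨v', hv'S, hvv', hv'v⟩ := exists_inverse_intertwiner (descSubalgebra cs) hEE hFF hES hFS
    (shapeIdem_sub_isNilpotent cs hσ hσ₁ he he₁ I)
  set v := F * E + (1 - F) * (1 - E) with hv
  have hvS : v ∈ descSubalgebra cs := add_mem (mul_mem hFS hES)
    (mul_mem (sub_mem (one_mem _) hFS) (sub_mem (one_mem _) hES))
  have hvE : v * E = F * v := by
    have hE0 : (1 - E) * E = 0 := by rw [sub_mul, one_mul, hEE, sub_self]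
    have hF0 : F * (1 - F) = 0 := by rw [mul_sub, mul_one, hFF, sub_self]
    have h1 : v * E = F * E := by
      rw [hv, add_mul, mul_assoc, hEE, mul_assoc, hE0, mul_zero, add_zero]
    have h2 : F * v = F * E := by
      rw [hv, mul_add, ← mul_assoc, hFF, ← mul_assoc, hF0, zero_mul, add_zero]
    rw [h1, h2]
  refine ⟨v, v', hvS, hv'S, hvv', hv'v, fun π hπ => ?_, hvE, ?_⟩
  · simp only [hv, map_add, map_mul, map_sub, map_one, hNe π hπ, hNF π hπ]
  · ext x
    constructor
    · rintro ⟨_, ⟨y, rfl⟩, rfl⟩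
      exact ⟨v * y, by simp only [← mul_assoc, hvE]⟩
    · rintro ⟨y, rfl⟩
      refine ⟨E * (v' * y), ⟨v' * y, rfl⟩, ?_⟩
      change v * (E * (v' * y)) = F * y
      rw [← mul_assoc, hvE, mul_assoc, ← mul_assoc v, hvv', one_mul]

end DPR
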